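/- arXiv:2402.11609 — 4 statements merged into one kernel-verified Lean document; each statement's English description precedes it below -/
import Mathlib

section
/- Let (Ω, F, μ) be a probability space, let R^S₁, …, R^S_S (S ≥ 1) be the rejection events of the superiority tests for S success metrics and R^G₁, …, R^G_G be the rejection events of the non-inferiority tests for G guardrail metrics, and let α ∈ [0,1]. Suppose that either (a) μ(R^Sᵢ) ≤ α/S for every i = 1, …, S, or (b) μ(R^Gⱼ) ≤ α for some j ∈ {1, …, G}. Then the probability of the shipping decision event, μ((⋃ᵢ R^Sᵢ) ∩ (⋂ⱼ R^Gⱼ)), is at most α. -/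
open MeasureTheory
open scoped ENNReal

/-- Type I error part of Proposition 3.1: for Decision Rule 1 with `S ≥ 1` success
metrics (superiority rejection events `RS`) and `G` guardrail metrics (non-inferiority
rejection events `RG`), if either every superiority test has rejection probability at
most `α / S`, or some non-inferiority test has rejection probability at most `α`, then
the shipping decision event has probability at most `α`. -/
theorem decision_rule_one_type_I_error
    {Ω : Type*} [MeasurableSpace Ω] (μ : Measure Ω) [IsProbabilityMeasure μ]
    (S G : ℕ) (hS : 1 ≤ S)
    (RS : Fin S → Set Ω) (hRS : ∀ i, MeasurableSet (RS i))
    (RG : Fin G → Set Ω) (hRG : ∀ j, MeasurableSet (RG j))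
    (α : ℝ≥0∞) (hα : α ≤ 1)
    (h : (∀ i, μ (RS i) ≤ α / S) ∨ (∃ j, μ (RG j) ≤ α)) :
    μ ((⋃ i, RS i) ∩ ⋂ j, RG j) ≤ α := by
  rcases h with h | ⟨j, hj⟩
  · calc μ ((⋃ i, RS i) ∩ ⋂ j, RG j) ≤ μ (⋃ i, RS i) := measure_mono Set.inter_subset_left
      _ ≤ ∑ i, μ (RS i) := measure_iUnion_fintype_le μ RS
      _ ≤ ∑ _i : Fin S, α / S := Finset.sum_le_sum fun i _ => h i
      _ = S * (α / S) := by simp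
      _ ≤ α := ENNReal.mul_div_le
  · exact (measure_mono (Set.inter_subset_right.trans (Set.iInter_subset RG j))).trans hj
end

section
/- Let (Ω, F, μ) be a probability space, let R^S₁, …, R^S_S (S ≥ 1) be the rejection events of the superiority tests for S success metrics, R^G₁, …, R^G_G the rejection events of the non-inferiority tests for G guardrail metrics, and let E₁, …, E_{S+G+D+Q} be the rejection events of the S+G deterioration tests on success and guardrail metrics, the D additional deterioration tests, and the Q quality tests. Let 0 ≤ α₋ < β ≤ 1 and set β* = (β − α₋)/((1 − α₋)(G+1)). Write B = (⋃ᵢ R^Sᵢ) ∩ (⋂ⱼ R^Gⱼ) and assume μ(B) > 0. Suppose (1) μ(R^Sᵢ) ≥ 1 − β* for every i and μ(R^Gⱼ) ≥ 1 − β* for every j, and (2) the conditional probability μ(E_k | B) ≤ α₋/(S+G+D+Q) for every k = 1, …, S+G+D+Q. Then the probability of the shipping decision event, μ(B ∩ (⋃_k E_k)ᶜ), is at least 1 − β. -/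
open MeasureTheory ProbabilityTheory
open scoped ENNReal

/-- Type II error (power) part of Proposition 4.1: with `S ≥ 1` success metrics, `G`
guardrail metrics, and `S + G + D + Q` deterioration/quality tests with rejection
events `E k`, if `αneg < β ≤ 1`, every superiority and non-inferiority test has
rejection probability at least `1 - β*` where `β* = (β - αneg)/((1 - αneg)(G + 1))`, and
conditionally on the success/guardrail decision event `B` each deterioration or
quality test rejects with probability at most `αneg / (S + G + D + Q)`, then the
Decision Rule 2 shipping event has probability at least `1 - β`. -/
theorem decision_rule_two_power
    {Ω : Type*} [MeasurableSpace Ω] (μ : Measure Ω) [IsProbabilityMeasure μ]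
    (S G D Q : ℕ) (hS : 1 ≤ S)
    (RS : Fin S → Set Ω) (hRS : ∀ i, MeasurableSet (RS i))
    (RG : Fin G → Set Ω) (hRG : ∀ j, MeasurableSet (RG j))
    (E : Fin (S + G + D + Q) → Set Ω) (hE : ∀ k, MeasurableSet (E k))
    (αneg β : ℝ≥0∞) (hαβ : αneg < β) (hβ : β ≤ 1)
    (B : Set Ω) (hB : B = (⋃ i, RS i) ∩ ⋂ j, RG j) (hBpos : μ B ≠ 0)
    (hpow : (∀ i, μ (RS i) ≥ 1 - (β - αneg) / ((1 - αneg) * (G + 1))) ∧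
            (∀ j, μ (RG j) ≥ 1 - (β - αneg) / ((1 - αneg) * (G + 1))))
    (hcond : ∀ k, (μ[|B]) (E k) ≤ αneg / (S + G + D + Q)) :
    μ (B ∩ (⋃ k, E k)ᶜ) ≥ 1 - β := by
  have hα1 : αneg < 1 := lt_of_lt_of_le hαβ hβ
  have hαt : αneg ≠ ∞ := hα1.ne_top
  have hβt : β ≠ ∞ := (lt_of_le_of_lt hβ ENNReal.one_lt_top).ne
  have ha1 : αneg.toReal < 1 := by
    simpa using (ENNReal.toReal_lt_toReal hαt ENNReal.one_ne_top).2 hα1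
  have hBm : MeasurableSet B := by
    rw [hB]
    exact (MeasurableSet.iUnion hRS).inter (MeasurableSet.iInter hRG)
  have hUm : MeasurableSet (⋃ k, E k) := MeasurableSet.iUnion hE
  -- the corrected type II level, as a real number
  obtain ⟨t, ht⟩ : ∃ t : ℝ, t = ((β - αneg) / ((1 - αneg) * (G + 1))).toReal := ⟨_, rfl⟩
  have htval : ((G : ℝ) + 1) * t * (1 - αneg.toReal) = β.toReal - αneg.toReal := by
    have h1 : (1 - αneg.toReal) ≠ 0 := by linarith
    have h2 : ((G : ℝ) + 1) ≠ 0 := by positivity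
    have h3 : ((G : ℝ≥0∞) + 1).toReal = (G : ℝ) + 1 := by
      rw [ENNReal.toReal_add (by simp) (by simp)]; simp
    rw [ht, ENNReal.toReal_div, ENNReal.toReal_mul, h3,
      ENNReal.toReal_sub_of_le hαβ.le hβt, ENNReal.toReal_sub_of_le hα1.le ENNReal.one_ne_top,
      ENNReal.toReal_one]
    field_simp
  have hfin : (β - αneg) / ((1 - αneg) * (G + 1)) ≠ ∞ := by
    apply ENNReal.div_ne_top
    · exact ENNReal.sub_ne_top hβt
    · exact mul_ne_zero (tsub_pos_of_lt hα1).ne' (by simp)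
  have key : ∀ A : Set Ω, MeasurableSet A →
      μ A ≥ 1 - (β - αneg) / ((1 - αneg) * (G + 1)) → μ.real Aᶜ ≤ t := by
    intro A hA h
    rw [probReal_compl_eq_one_sub hA]
    have h1 : (1 : ℝ≥0∞) ≤ μ A + (β - αneg) / ((1 - αneg) * (G + 1)) :=
      tsub_le_iff_right.1 h
    have h2 := ENNReal.toReal_mono (ENNReal.add_ne_top.2 ⟨measure_ne_top μ A, hfin⟩) h1
    rw [ENNReal.toReal_add (measure_ne_top μ A) hfin, ← ht, ENNReal.toReal_one] at h2
    have h3 : μ.real A = (μ A).toReal := rfl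
    linarith
  have hBc : μ.real Bᶜ ≤ ((G : ℝ) + 1) * t := by
    have hsub : Bᶜ ⊆ (RS ⟨0, hS⟩)ᶜ ∪ ⋃ j, (RG j)ᶜ := by
      intro x hx
      by_contra hcon
      simp only [Set.mem_union, Set.mem_iUnion, Set.mem_compl_iff, not_or, not_exists,
        not_not] at hcon
      apply hx
      rw [hB]
      exact ⟨Set.mem_iUnion.2 ⟨_, hcon.1⟩, Set.mem_iInter.2 hcon.2⟩
    calc μ.real Bᶜ ≤ μ.real ((RS ⟨0, hS⟩)ᶜ ∪ ⋃ j, (RG j)ᶜ) := measureReal_mono hsub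
      _ ≤ μ.real (RS ⟨0, hS⟩)ᶜ + μ.real (⋃ j, (RG j)ᶜ) := measureReal_union_le _ _
      _ ≤ t + ∑ j : Fin G, μ.real (RG j)ᶜ :=
          add_le_add (key _ (hRS _) (hpow.1 _)) (measureReal_iUnion_fintype_le _)
      _ ≤ t + ∑ j : Fin G, t := by
          gcongr with j
          exact key _ (hRG _) (hpow.2 _)
      _ = ((G : ℝ) + 1) * t := by simp; ring
  have hBr : 1 - β.toReal ≤ (1 - αneg.toReal) * μ.real B := by
    rw [probReal_compl_eq_one_sub hBm] at hBc
    have := mul_le_mul_of_nonneg_right hBc (by linarith : (0 : ℝ) ≤ 1 - αneg.toReal)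
    nlinarith
  have hU : (μ[|B]) (⋃ k, E k) ≤ αneg := by
    calc (μ[|B]) (⋃ k, E k) ≤ ∑ k, (μ[|B]) (E k) := measure_iUnion_fintype_le _ _
      _ ≤ ∑ _k : Fin (S + G + D + Q), αneg / (S + G + D + Q) :=
          Finset.sum_le_sum fun k _ => hcond k
      _ = ((S : ℝ≥0∞) + G + D + Q) * (αneg / (S + G + D + Q)) := by simp
      _ ≤ αneg := ENNReal.mul_div_le
  have hBU : μ (B ∩ ⋃ k, E k) ≤ αneg * μ B := by
    rw [← cond_mul_eq_inter hBm]
    gcongr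
  have hBUr : μ.real (B ∩ ⋃ k, E k) ≤ αneg.toReal * μ.real B := by
    have := ENNReal.toReal_mono (ENNReal.mul_ne_top hαt (measure_ne_top μ B)) hBU
    rwa [ENNReal.toReal_mul] at this
  have hsplit : μ.real (B ∩ ⋃ k, E k) + μ.real (B ∩ (⋃ k, E k)ᶜ) = μ.real B := by
    rw [← Set.diff_eq]
    exact measureReal_inter_add_diff hUm
  have hfinal : 1 - β.toReal ≤ μ.real (B ∩ (⋃ k, E k)ᶜ) := by linarith
  refine (ENNReal.toReal_le_toReal (by simp) (measure_ne_top μ _)).1 ?_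
  rw [ENNReal.toReal_sub_of_le hβ ENNReal.one_ne_top, ENNReal.toReal_one]
  exact hfinal
end

section
/- Let (Ω, F, μ) be a probability space, let R^S₁, …, R^S_S (S ≥ 1) be the rejection events of the superiority tests for S success metrics and R^G₁, …, R^G_G the rejection events of the non-inferiority tests for G guardrail metrics, and write B = (⋃ᵢ R^Sᵢ) ∩ (⋂ⱼ R^Gⱼ) with μ(B) > 0. Let D, Q be natural numbers, α₋ ∈ [0,1], set φ = (S + D + Q − 1)·α₋/(S+G+D+Q), let β ∈ [0,1] with φ < β, and set β* = (β − φ)/((1 − φ)(G+1)). Let N be the event that no deterioration test and no quality test rejects. Assume (1) μ(R^Sᵢ) ≥ 1 − β* for every i and μ(R^Gⱼ) ≥ 1 − β* for every j, and (2) μ(Nᶜ | B) ≤ φ. Then μ(B ∩ N) ≥ 1 − β. -/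
open MeasureTheory ProbabilityTheory
open scoped ENNReal

theorem aux_power
    {Ω : Type*} [MeasurableSpace Ω] (μ : Measure Ω) [IsProbabilityMeasure μ]
    (S G : ℕ) (hS : 1 ≤ S)
    (RS : Fin S → Set Ω) (hRS : ∀ i, MeasurableSet (RS i))
    (RG : Fin G → Set Ω) (hRG : ∀ j, MeasurableSet (RG j))
    (B : Set Ω) (hB : B = (⋃ i, RS i) ∩ ⋂ j, RG j) (hBpos : μ B ≠ 0)
    (N : Set Ω) (hNmeas : MeasurableSet N)
    (φ β : ℝ≥0∞) (hβ : β ≤ 1) (hφβ : φ < β)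
    (hpowS : ∀ i, μ (RS i) ≥ 1 - (β - φ) / ((1 - φ) * (G + 1)))
    (hpowG : ∀ j, μ (RG j) ≥ 1 - (β - φ) / ((1 - φ) * (G + 1)))
    (hcond : (μ[|B]) Nᶜ ≤ φ) :
    μ (B ∩ N) ≥ 1 - β := by
  have hφ1 : φ < 1 := hφβ.trans_le hβ
  have hφt : φ ≠ ∞ := (hφ1.trans ENNReal.one_lt_top).ne
  have hβt : β ≠ ∞ := (hβ.trans_lt ENNReal.one_lt_top).ne
  have hBm : MeasurableSet B := by
    rw [hB]
    exact (MeasurableSet.iUnion hRS).inter (MeasurableSet.iInter hRG)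
  have hf1 : φ.toReal < 1 := by
    simpa using (ENNReal.toReal_lt_toReal hφt ENNReal.one_ne_top).2 hφ1
  set x : ℝ≥0∞ := (β - φ) / ((1 - φ) * (G + 1)) with hx
  have hd : (1 - φ) * ((G : ℝ≥0∞) + 1) ≠ 0 :=
    mul_ne_zero (tsub_pos_of_lt hφ1).ne' (by simp)
  have hxt : x ≠ ∞ := ENNReal.div_ne_top (ENNReal.sub_ne_top hβt) hd
  have hxr : x.toReal = (β.toReal - φ.toReal) / ((1 - φ.toReal) * (G + 1)) := by
    rw [hx, ENNReal.toReal_div, ENNReal.toReal_mul, ENNReal.toReal_sub_of_le hφβ.le hβt,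
      ENNReal.toReal_sub_of_le hφ1.le ENNReal.one_ne_top,
      ENNReal.toReal_add (ENNReal.natCast_ne_top G) ENNReal.one_ne_top]
    simp
  have key : ∀ R : Set Ω, MeasurableSet R → μ R ≥ 1 - x → μ Rᶜ ≤ x := by
    intro R hR h
    rw [prob_compl_eq_one_sub hR]
    exact tsub_le_iff_tsub_le.1 h
  have hBc : μ Bᶜ ≤ x * (G + 1) := by
    have hsub : Bᶜ ⊆ (RS ⟨0, hS⟩)ᶜ ∪ ⋃ j, (RG j)ᶜ := by
      intro w hw
      by_contra hcon
      apply hw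
      rw [hB]
      simp only [Set.mem_union, Set.mem_compl_iff, Set.mem_iUnion, not_or, not_not,
        not_exists] at hcon
      exact ⟨Set.mem_iUnion.2 ⟨_, hcon.1⟩, Set.mem_iInter.2 hcon.2⟩
    calc μ Bᶜ ≤ μ ((RS ⟨0, hS⟩)ᶜ ∪ ⋃ j, (RG j)ᶜ) := measure_mono hsub
      _ ≤ μ (RS ⟨0, hS⟩)ᶜ + μ (⋃ j, (RG j)ᶜ) := measure_union_le _ _
      _ ≤ x + ∑ j : Fin G, x := by
        refine add_le_add (key _ (hRS _) (hpowS _)) ?_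
        refine (measure_iUnion_fintype_le μ _).trans ?_
        exact Finset.sum_le_sum fun j _ => key _ (hRG j) (hpowG j)
      _ = x * (G + 1) := by
        simp only [Finset.sum_const, Finset.card_univ, Fintype.card_fin, nsmul_eq_mul]
        ring
  have hBr : 1 - μ.real B ≤ x.toReal * (G + 1) := by
    rw [← probReal_compl_eq_one_sub hBm]
    have := ENNReal.toReal_mono
      (ENNReal.mul_ne_top hxt (by finiteness)) hBc
    rwa [ENNReal.toReal_mul,
      ENNReal.toReal_add (ENNReal.natCast_ne_top G) ENNReal.one_ne_top,
      ENNReal.toReal_natCast, ENNReal.toReal_one] at this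
  have hmul : μ (B ∩ Nᶜ) ≤ φ * μ B := by
    rw [← cond_mul_eq_inter hBm Nᶜ μ]
    gcongr
  have hmr : μ.real (B ∩ Nᶜ) ≤ φ.toReal * μ.real B := by
    have := ENNReal.toReal_mono (by finiteness) hmul
    rwa [ENNReal.toReal_mul] at this
  have hsplit : μ.real (B ∩ N) + μ.real (B ∩ Nᶜ) = μ.real B := by
    rw [← Set.sdiff_eq]
    exact measureReal_inter_add_sdiff hNmeas
  have hxx : x.toReal * (G + 1) * (1 - φ.toReal) = β.toReal - φ.toReal := by
    rw [hxr]
    have h1 : 1 - φ.toReal ≠ 0 := by linarith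
    have h2 : (G : ℝ) + 1 ≠ 0 := by positivity
    field_simp
  have hfin : 1 - β.toReal ≤ μ.real (B ∩ N) := by
    have := mul_le_mul_of_nonneg_right hBr (by linarith : 0 ≤ 1 - φ.toReal)
    nlinarith
  have h1 : (1 - β).toReal ≤ (μ (B ∩ N)).toReal := by
    rw [ENNReal.toReal_sub_of_le hβ ENNReal.one_ne_top]
    rw [ENNReal.toReal_one]
    exact hfin
  exact (ENNReal.toReal_le_toReal (by finiteness) (by finiteness)).1 h1

/-- Type II error part of the improved appendix version of Proposition 4.1: with
`φ = (S + D + Q - 1) * αneg / (S + G + D + Q)` and `φ < β ≤ 1`, if every superiority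
and non-inferiority test has rejection probability at least `1 - β*` with
`β* = (β - φ)/((1 - φ)(G + 1))`, and conditionally on the success/guardrail decision
event `B` the event that some deterioration or quality test rejects has probability
at most `φ`, then the shipping event `B ∩ N` has probability at least `1 - β`. -/
theorem improved_decision_rule_two_power
    {Ω : Type*} [MeasurableSpace Ω] (μ : Measure Ω) [IsProbabilityMeasure μ]
    (S G D Q : ℕ) (hS : 1 ≤ S)
    (RS : Fin S → Set Ω) (hRS : ∀ i, MeasurableSet (RS i))
    (RG : Fin G → Set Ω) (hRG : ∀ j, MeasurableSet (RG j))
    (B : Set Ω) (hB : B = (⋃ i, RS i) ∩ ⋂ j, RG j) (hBpos : μ B ≠ 0)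
    (N : Set Ω) (hNmeas : MeasurableSet N)
    (αneg β : ℝ≥0∞) (hαneg : αneg ≤ 1) (hβ : β ≤ 1)
    (hφβ : ((S + D + Q - 1 : ℕ) : ℝ≥0∞) * αneg / (S + G + D + Q) < β)
    (hpowS : ∀ i, μ (RS i) ≥
      1 - (β - ((S + D + Q - 1 : ℕ) : ℝ≥0∞) * αneg / (S + G + D + Q)) /
        ((1 - ((S + D + Q - 1 : ℕ) : ℝ≥0∞) * αneg / (S + G + D + Q)) * (G + 1)))
    (hpowG : ∀ j, μ (RG j) ≥
      1 - (β - ((S + D + Q - 1 : ℕ) : ℝ≥0∞) * αneg / (S + G + D + Q)) /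
        ((1 - ((S + D + Q - 1 : ℕ) : ℝ≥0∞) * αneg / (S + G + D + Q)) * (G + 1)))
    (hcond : (μ[|B]) Nᶜ ≤ ((S + D + Q - 1 : ℕ) : ℝ≥0∞) * αneg / (S + G + D + Q)) :
    μ (B ∩ N) ≥ 1 - β := by
  exact aux_power μ S G hS RS hRS RG hRG B hB hBpos N hNmeas _ β hβ hφβ hpowS hpowG hcond
end

section
/- Let β be a real number with 0 ≤ β ≤ 1 and let S, G be natural numbers with S ≥ 1 and G ≥ 1. Then (1 − β/(G+1))^G · (1 − (β/(G+1))^S) ≥ 1 − β. -/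
/-- Under Decision Rule 1 with all tests independent and designed for the corrected
power level `1 - β / (G + 1)`, the global power
`(1 - β / (G + 1))^G * (1 - (β / (G + 1))^S)` is at least the nominal `1 - β`. -/
theorem decision_rule_one_independent_power_ge
    (β : ℝ) (hβ0 : 0 ≤ β) (hβ1 : β ≤ 1) (S G : ℕ) (hS : 1 ≤ S) (hG : 1 ≤ G) :
    (1 - β / (G + 1)) ^ G * (1 - (β / (G + 1)) ^ S) ≥ 1 - β := by
  have hpos : (0 : ℝ) < (G : ℝ) + 1 := by positivity
  set x : ℝ := β / (G + 1) with hx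
  have hx0 : 0 ≤ x := by positivity
  have hxβ : ((G : ℝ) + 1) * x = β := by
    rw [hx]; field_simp
  have hx1 : x ≤ 1 := by
    rw [hx, div_le_one hpos]
    have : (0 : ℝ) ≤ G := Nat.cast_nonneg G
    linarith
  have hpow : x ^ S ≤ x := pow_le_of_le_one hx0 hx1 (by omega)
  have h1 : (1 - x) ^ G * (1 - x) ≤ (1 - x) ^ G * (1 - x ^ S) :=
    mul_le_mul_of_nonneg_left (by linarith) (pow_nonneg (by linarith) G)
  have h2 := one_add_mul_le_pow (a := -x) (by linarith) (G + 1)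
  rw [pow_succ] at h2
  push_cast at h2
  rw [← sub_eq_add_neg] at h2
  linarith
end
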